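/- Let F be a field, D a subring of F, and Z a nonempty patch closed subset of Zar_F(D). Then Z is connected in the Zariski topology if and only if X(Z) is connected in the Zariski topology for every projective model X of F/D. -/

import Mathlib

/-!
Common definitions: valuation rings of a field, the Zariski--Riemann space
`Zar_F(D)` with its Zariski and patch topologies, domination of local subrings,
residual algebraicity, integral closedness, and projective models of `F/D`.
-/

variable {F : Type*} [Field F]

/-- `x` lies in the maximal ideal (set of nonunits) of the (local) subring `R` of `F`. -/
def MemMaxIdeal (R : Subring F) (x : F) : Prop :=
  ∃ h : x ∈ R, ¬ IsUnit (⟨x, h⟩ : R)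

/-- The local ring `R` dominates the local ring `S` (both subrings of `F`):
`S ⊆ R` and the maximal ideal of `R` contracts to the maximal ideal of `S`. -/
def Dominates (R S : Subring F) : Prop :=
  S ≤ R ∧ ∀ x ∈ S, (MemMaxIdeal S x ↔ MemMaxIdeal R x)

/-- `V` is a valuation ring of the field `F`: for every nonzero `x ∈ F`,
`x ∈ V` or `x⁻¹ ∈ V`. -/
def IsValSubring (V : Subring F) : Prop :=
  ∀ x : F, x ≠ 0 → x ∈ V ∨ x⁻¹ ∈ V

/-- `Zar_F(D)`: the valuation rings of `F` containing `D`. -/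
def zarSet (D : Subring F) : Set (Subring F) :=
  {V | IsValSubring V ∧ D ≤ V}

/-- `Dom_F(D)`: the valuation rings of `F` dominating the local subring `D`. -/
def domSet (D : Subring F) : Set (Subring F) :=
  {V | IsValSubring V ∧ Dominates V D}

/-- The Zariski topology on a collection `X` of subrings of `F`, with basic open sets
`U(x₁,…,xₙ) = {R ∈ X : x₁,…,xₙ ∈ R}`. -/
def zariskiTop (X : Set (Subring F)) : TopologicalSpace X :=
  TopologicalSpace.generateFrom
    {U | ∃ s : Finset F, U = {R : X | ∀ x ∈ s, x ∈ (R : Subring F)}}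

/-- The patch topology on a collection `X` of subrings of `F`: generated by the
quasicompact Zariski-open sets together with their complements. -/
def patchTop (X : Set (Subring F)) : TopologicalSpace X :=
  TopologicalSpace.generateFrom
    ({U | @IsOpen _ (zariskiTop X) U ∧ @IsCompact _ (zariskiTop X) U} ∪
      {V | ∃ U, @IsOpen _ (zariskiTop X) U ∧ @IsCompact _ (zariskiTop X) U ∧ V = Uᶜ})

/-- `R` is residually algebraic over `D`: the residue field extension
`D/m_D → R/m_R` is algebraic, i.e. each element of `R` satisfies, modulo the
maximal ideal of `R`, a monic polynomial with coefficients in `D`. -/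
def ResiduallyAlgebraic (D R : Subring F) : Prop :=
  ∀ x ∈ R, ∃ p : Polynomial F, p.Monic ∧ (∀ i, p.coeff i ∈ D) ∧ MemMaxIdeal R (p.eval x)

/-- `R` is integrally closed in `F`: every element of `F` integral over `R` lies in `R`. -/
def IntegrallyClosedIn (R : Subring F) : Prop :=
  ∀ x : F, (∃ p : Polynomial F, p.Monic ∧ (∀ i, p.coeff i ∈ R) ∧ p.eval x = 0) → x ∈ R

/-- The localization of the subring `A` of `F` at the prime ideal `P`, viewed as the
subring of `F` generated by the fractions `a/b` with `a, b ∈ A`, `b ∉ P`. -/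
def localizationSubring (A : Subring F) (P : Ideal A) : Subring F :=
  Subring.closure {z : F | ∃ a b : A, b ∉ P ∧ z = (a : F) * (b : F)⁻¹}

/-- The ring `D[x₁/xᵢ, …, xₙ/xᵢ]`. -/
def modelChart (D : Subring F) {n : ℕ} (x : Fin n → F) (i : Fin n) : Subring F :=
  Subring.closure ((D : Set F) ∪ {y | ∃ j, y = x j * (x i)⁻¹})

/-- `X` is the projective model of `F/D` defined by some nonzero elements
`x₀, …, xₙ` of `F`: the set of all localizations of the rings
`D[x₀/xᵢ, …, xₙ/xᵢ]` at their prime ideals. -/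
def IsProjModel (D : Subring F) (X : Set (Subring F)) : Prop :=
  ∃ (n : ℕ) (x : Fin (n + 1) → F), (∀ i, x i ≠ 0) ∧
    X = {R | ∃ (i : Fin (n + 1)) (P : Ideal (modelChart D x i)),
          P.IsPrime ∧ R = localizationSubring (modelChart D x i) P}

/-- `X(Z)`: the members of the projective model `X` dominated by some valuation ring
in `Z`. -/
def modelImage (X Z : Set (Subring F)) : Set (Subring F) :=
  {α ∈ X | ∃ V ∈ Z, Dominates V α}

/-- `A(Y)`: the intersection of a collection `Y` of subrings of `F`, as a subset of `F`. -/
def ringsInter (Y : Set (Subring F)) : Set F :=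
  ⋂ R ∈ Y, (R : Set F)

/-- The nonunits of a subring of a field, in terms of inverses taken in the field. -/
theorem memMaxIdeal_iff (R : Subring F) (x : F) :
    MemMaxIdeal R x ↔ x ∈ R ∧ (x⁻¹ ∈ R → x = 0) := by
  constructor
  · rintro ⟨h, hu⟩
    refine ⟨h, fun hi => ?_⟩
    by_contra h0
    exact hu (IsUnit.of_mul_eq_one ⟨x⁻¹, hi⟩ (Subtype.ext (mul_inv_cancel₀ h0)))
  · rintro ⟨h, hi⟩
    refine ⟨h, fun hu => ?_⟩
    obtain ⟨⟨y, hy⟩, hxy⟩ := hu.exists_right_inv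
    have hxy' : x * y = 1 := congrArg Subtype.val hxy
    have hinv : x⁻¹ = y := inv_eq_of_mul_eq_one_right hxy'
    have h0 : x = 0 := hi (hinv ▸ hy)
    simp [h0] at hxy'

theorem Dominates.inv_mem {V R : Subring F} (h : Dominates V R) {x : F} (hx : x ∈ R)
    (hxi : x⁻¹ ∈ V) : x⁻¹ ∈ R := by
  by_contra hn
  have h1 : MemMaxIdeal R x := (memMaxIdeal_iff R x).2 ⟨hx, fun h' => absurd h' hn⟩
  have h0 : x = 0 := ((memMaxIdeal_iff V x).1 ((h.2 x hx).1 h1)).2 hxi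
  simp [h0, R.zero_mem] at hn

theorem le_localizationSubring (A : Subring F) (P : Ideal A) [hP : P.IsPrime] :
    A ≤ localizationSubring A P := fun a ha =>
  Subring.subset_closure ⟨⟨a, ha⟩, 1, hP.one_notMem, by simp⟩

theorem inv_mem_localizationSubring (A : Subring F) (P : Ideal A) {b : A} (hb : b ∉ P) :
    (b : F)⁻¹ ∈ localizationSubring A P :=
  Subring.subset_closure ⟨1, b, hb, by simp⟩

theorem coe_ne_zero_of_notMem {A : Subring F} {P : Ideal A} {b : A} (hb : b ∉ P) :
    (b : F) ≠ 0 := by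
  rintro h
  have : b = 0 := Subtype.ext h
  exact hb (this ▸ P.zero_mem)

theorem mem_localizationSubring_iff (A : Subring F) (P : Ideal A) [hP : P.IsPrime] (z : F) :
    z ∈ localizationSubring A P ↔ ∃ a b : A, b ∉ P ∧ z = (a : F) * (b : F)⁻¹ := by
  refine ⟨fun hz => ?_, fun hz => Subring.subset_closure hz⟩
  induction hz using Subring.closure_induction with
  | mem x hx => exact hx
  | zero => exact ⟨0, 1, hP.one_notMem, by simp⟩
  | one => exact ⟨1, 1, hP.one_notMem, by simp⟩
  | add x y _ _ hx hy =>
    obtain ⟨a, b, hb, rfl⟩ := hx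
    obtain ⟨c, d, hd, rfl⟩ := hy
    have hb0 := coe_ne_zero_of_notMem hb
    have hd0 := coe_ne_zero_of_notMem hd
    refine ⟨a * d + c * b, b * d, fun h => (hP.mem_or_mem h).elim hb hd, ?_⟩
    push_cast
    field_simp
  | neg x _ hx =>
    obtain ⟨a, b, hb, rfl⟩ := hx
    exact ⟨-a, b, hb, by push_cast; ring⟩
  | mul x y _ _ hx hy =>
    obtain ⟨a, b, hb, rfl⟩ := hx
    obtain ⟨c, d, hd, rfl⟩ := hy
    refine ⟨a * c, b * d, fun h => (hP.mem_or_mem h).elim hb hd, ?_⟩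
    push_cast
    rw [mul_inv]
    ring

/-- The valuation subring in the sense of Mathlib attached to a subring that is a
valuation ring of `F`. -/
def IsValSubring.toValuationSubring {V : Subring F} (hV : IsValSubring V) :
    ValuationSubring F :=
  { V with
    mem_or_inv_mem' := fun x => by
      by_cases h0 : x = 0
      · exact Or.inl (h0 ▸ V.zero_mem)
      · exact hV x h0 }

theorem IsValSubring.mem_toValuationSubring {V : Subring F} (hV : IsValSubring V) {x : F} :
    x ∈ hV.toValuationSubring ↔ x ∈ V := Iff.rfl

/-- A valuation ring dominates the localization of any subring at its center. -/
theorem IsValSubring.exists_dominates_localizationSubring {V : Subring F}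
    (hV : IsValSubring V) {A : Subring F} (hA : A ≤ V) :
    ∃ P : Ideal A, P.IsPrime ∧ Dominates V (localizationSubring A P) := by
  have : IsLocalRing V := inferInstanceAs (IsLocalRing hV.toValuationSubring)
  let P : Ideal A := (IsLocalRing.maximalIdeal V).comap (Subring.inclusion hA)
  have hP : P.IsPrime := Ideal.IsPrime.comap _
  have hmem (a : A) : a ∈ P ↔ ((a : F)⁻¹ ∈ V → (a : F) = 0) := by
    have h : a ∈ P ↔ MemMaxIdeal V a :=
      ⟨fun h => ⟨hA a.2, h⟩, fun ⟨_, h⟩ => h⟩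
    rw [h, memMaxIdeal_iff]
    exact and_iff_right (hA a.2)
  have hle : localizationSubring A P ≤ V := by
    refine Subring.closure_le.2 ?_
    rintro _ ⟨a, b, hb, rfl⟩
    rw [hmem] at hb
    push Not at hb
    exact V.mul_mem (hA a.2) hb.1
  refine ⟨P, hP, hle, fun x hx => ?_⟩
  rw [memMaxIdeal_iff, memMaxIdeal_iff]
  refine ⟨fun h => ⟨hle hx, fun hi => ?_⟩, fun h => ⟨hx, fun hi => h.2 (hle hi)⟩⟩
  refine h.2 ?_
  obtain ⟨a, b, hb, rfl⟩ := (mem_localizationSubring_iff A P x).1 hx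
  by_cases ha : a ∈ P
  · have hb0 := coe_ne_zero_of_notMem hb
    have ha0 : (a : F) = 0 := (hmem a).1 ha (by
      have := V.mul_mem hi (hle (inv_mem_localizationSubring A P hb))
      rwa [mul_inv, inv_inv, mul_assoc, mul_inv_cancel₀ hb0, mul_one] at this)
    simp [ha0]
  · exact Subring.subset_closure ⟨b, a, ha, by rw [mul_inv, inv_inv, mul_comm]⟩

theorem le_modelChart (D : Subring F) {n : ℕ} (x : Fin n → F) (i : Fin n) :
    D ≤ modelChart D x i := fun _ ha => Subring.subset_closure (Or.inl ha)

theorem div_mem_modelChart (D : Subring F) {n : ℕ} (x : Fin n → F) (i j : Fin n) :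
    x j * (x i)⁻¹ ∈ modelChart D x i := Subring.subset_closure (Or.inr ⟨j, rfl⟩)

theorem modelChart_le {D V : Subring F} {n : ℕ} {x : Fin n → F} {i : Fin n} (hD : D ≤ V)
    (h : ∀ j, x j * (x i)⁻¹ ∈ V) : modelChart D x i ≤ V := by
  refine Subring.closure_le.2 ?_
  rintro _ (ha | ⟨j, rfl⟩)
  · exact hD ha
  · exact h j

/-- A valuation ring containing `D` contains some chart of each projective model. -/
theorem IsValSubring.exists_modelChart_le {D V : Subring F} (hV : IsValSubring V)
    (hD : D ≤ V) {n : ℕ} {x : Fin (n + 1) → F} (hx : ∀ i, x i ≠ 0) :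
    ∃ i, modelChart D x i ≤ V := by
  obtain ⟨i, hi⟩ := Finite.exists_max fun i => hV.toValuationSubring.valuation (x i)
  refine ⟨i, modelChart_le hD fun j => ?_⟩
  rw [← hV.mem_toValuationSubring, ← ValuationSubring.valuation_le_one_iff, map_mul, map_inv₀]
  have h0 : hV.toValuationSubring.valuation (x i) ≠ 0 :=
    (Valuation.ne_zero_iff _).2 (hx i)
  exact mul_inv_le_one_of_le₀ (hi j) zero_le

/-- If a ring in a projective model is dominated by `V`, then it contains each chart
contained in `V`. -/
theorem modelChart_le_localizationSubring {D V : Subring F} {n : ℕ} {x : Fin (n + 1) → F}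
    (hx : ∀ i, x i ≠ 0) {i j : Fin (n + 1)} {P : Ideal (modelChart D x i)} [P.IsPrime]
    (h : Dominates V (localizationSubring (modelChart D x i) P)) (hj : modelChart D x j ≤ V) :
    modelChart D x j ≤ localizationSubring (modelChart D x i) P := by
  have hle := le_localizationSubring (modelChart D x i) P
  refine modelChart_le ((le_modelChart D x i).trans hle) fun k => ?_
  have h1 : x i * (x j)⁻¹ ∈ localizationSubring (modelChart D x i) P := by
    have := h.inv_mem (hle (div_mem_modelChart D x i j)) (by
      rw [mul_inv, inv_inv, mul_comm]
      exact hj (div_mem_modelChart D x j i))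
    rwa [mul_inv, inv_inv, mul_comm] at this
  have h2 := Subring.mul_mem _ (hle (div_mem_modelChart D x i k)) h1
  rwa [mul_assoc, inv_mul_cancel_left₀ (hx i)] at h2

theorem localizationSubring_le_of_dominates {D V : Subring F} {n : ℕ} {x : Fin (n + 1) → F}
    (hx : ∀ i, x i ≠ 0) {i j : Fin (n + 1)} {P : Ideal (modelChart D x i)} [P.IsPrime]
    {Q : Ideal (modelChart D x j)} [Q.IsPrime]
    (hP : Dominates V (localizationSubring (modelChart D x i) P))
    (hQ : Dominates V (localizationSubring (modelChart D x j) Q)) :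
    localizationSubring (modelChart D x j) Q ≤ localizationSubring (modelChart D x i) P := by
  have hle := modelChart_le_localizationSubring hx hP
    ((le_localizationSubring (modelChart D x j) Q).trans hQ.1)
  refine Subring.closure_le.2 ?_
  rintro _ ⟨a, b, hb, rfl⟩
  exact Subring.mul_mem _ (hle a.2)
    (hP.inv_mem (hle b.2) (hQ.1 (inv_mem_localizationSubring _ Q hb)))

/-- A ring dominates at most one member of a projective model. -/
theorem IsProjModel.eq_of_dominates {D V : Subring F} {X : Set (Subring F)}
    (hX : IsProjModel D X) {α β : Subring F} (hα : α ∈ X) (hβ : β ∈ X)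
    (hVα : Dominates V α) (hVβ : Dominates V β) : α = β := by
  obtain ⟨n, x, hx, rfl⟩ := hX
  obtain ⟨i, P, _, rfl⟩ := hα
  obtain ⟨j, Q, _, rfl⟩ := hβ
  exact le_antisymm (localizationSubring_le_of_dominates hx hVβ hVα)
    (localizationSubring_le_of_dominates hx hVα hVβ)

/-- Each valuation ring containing `D` dominates a member of each projective model. -/
theorem IsProjModel.exists_dominates {D V : Subring F} {X : Set (Subring F)}
    (hX : IsProjModel D X) (hV : V ∈ zarSet D) : ∃ α ∈ X, Dominates V α := by
  obtain ⟨n, x, hx, rfl⟩ := hX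
  obtain ⟨i, hi⟩ := hV.1.exists_modelChart_le hV.2 hx
  obtain ⟨P, hP, hd⟩ := hV.1.exists_dominates_localizationSubring hi
  exact ⟨_, ⟨i, P, hP, rfl⟩, hd⟩

/-- The basic open sets form a basis of the Zariski topology. -/
theorem isOpen_zariskiTop_iff {X : Set (Subring F)} {U : Set X} :
    @IsOpen _ (zariskiTop X) U ↔
      ∀ R ∈ U, ∃ s : Finset F, (∀ x ∈ s, x ∈ R.1) ∧
        ∀ S : X, (∀ x ∈ s, x ∈ S.1) → S ∈ U := by
  classical
  constructor
  · intro hU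
    induction hU with
    | basic U hU =>
      obtain ⟨s, rfl⟩ := hU
      exact fun R hR => ⟨s, hR, fun S hS => hS⟩
    | univ => exact fun R _ => ⟨∅, by simp, by simp⟩
    | inter U V _ _ hU hV =>
      rintro R ⟨h1, h2⟩
      obtain ⟨s, hs, hsU⟩ := hU R h1
      obtain ⟨t, ht, htV⟩ := hV R h2
      refine ⟨s ∪ t, fun x hx => (Finset.mem_union.1 hx).elim (hs x) (ht x), fun S hS =>
        ⟨hsU S fun x hx => hS x (Finset.mem_union_left _ hx),
          htV S fun x hx => hS x (Finset.mem_union_right _ hx)⟩⟩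
    | sUnion C _ hC =>
      rintro R ⟨U, hU, hR⟩
      obtain ⟨s, hs, hsU⟩ := hC U hU R hR
      exact ⟨s, hs, fun S hS => ⟨U, hU, hsU S hS⟩⟩
  · intro h
    let _ := zariskiTop X
    refine isOpen_iff_forall_mem_open.2 fun R hR => ?_
    obtain ⟨s, hs, hsU⟩ := h R hR
    exact ⟨_, hsU, TopologicalSpace.isOpen_generateFrom_of_mem ⟨s, rfl⟩, hs⟩

/-- The limit of an ultrafilter of valuation rings: the ring of those elements that lie
in almost all of them. -/
def ultrafilterLimit {D : Subring F} (f : Ultrafilter (zarSet D)) : Subring F where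
  carrier := {x | ∀ᶠ V in (f : Filter (zarSet D)), x ∈ V.1}
  mul_mem' ha hb := by filter_upwards [ha, hb] with V h1 h2 using V.1.mul_mem h1 h2
  one_mem' := Filter.Eventually.of_forall fun V => V.1.one_mem
  add_mem' ha hb := by filter_upwards [ha, hb] with V h1 h2 using V.1.add_mem h1 h2
  zero_mem' := Filter.Eventually.of_forall fun V => V.1.zero_mem
  neg_mem' ha := by filter_upwards [ha] with V h1 using V.1.neg_mem h1

theorem mem_ultrafilterLimit {D : Subring F} {f : Ultrafilter (zarSet D)} {x : F} :
    x ∈ ultrafilterLimit f ↔ ∀ᶠ V in (f : Filter (zarSet D)), x ∈ V.1 := Iff.rfl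

theorem ultrafilterLimit_mem_zarSet {D : Subring F} (f : Ultrafilter (zarSet D)) :
    ultrafilterLimit f ∈ zarSet D := by
  refine ⟨fun x hx => ?_, fun x hx => Filter.Eventually.of_forall fun V => V.2.2 hx⟩
  rw [mem_ultrafilterLimit, mem_ultrafilterLimit, ← Ultrafilter.eventually_or]
  exact Filter.Eventually.of_forall fun V => V.2.1 x hx

theorem mem_of_isOpen_zariskiTop {D : Subring F} {f : Ultrafilter (zarSet D)}
    {U : Set (zarSet D)} (hU : @IsOpen _ (zariskiTop (zarSet D)) U)
    (h : (⟨_, ultrafilterLimit_mem_zarSet f⟩ : zarSet D) ∈ U) : U ∈ f := by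
  obtain ⟨s, hs, hsU⟩ := isOpen_zariskiTop_iff.1 hU _ h
  have : ∀ᶠ V in (f : Filter (zarSet D)), ∀ x ∈ s, x ∈ V.1 :=
    (Filter.eventually_all_finset s).2 hs
  exact Filter.mem_of_superset this hsU

theorem ultrafilterLimit_mem_of_isCompact {D : Subring F} {f : Ultrafilter (zarSet D)}
    {U : Set (zarSet D)} (hU : @IsOpen _ (zariskiTop (zarSet D)) U)
    (hc : @IsCompact _ (zariskiTop (zarSet D)) U) (hf : U ∈ f) :
    (⟨_, ultrafilterLimit_mem_zarSet f⟩ : zarSet D) ∈ U := by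
  let _ := zariskiTop (zarSet D)
  obtain ⟨V, hV, hfV⟩ := isCompact_iff_ultrafilter_le_nhds.1 hc f (Filter.le_principal_iff.2 hf)
  obtain ⟨s, hs, hsU⟩ := isOpen_zariskiTop_iff.1 hU V hV
  refine hsU _ fun x hx => ?_
  refine hfV (IsOpen.mem_nhds (s := {W : zarSet D | x ∈ W.1}) ?_ (hs x hx))
  exact TopologicalSpace.isOpen_generateFrom_of_mem ⟨{x}, by simp⟩

/-- Patch closed sets of valuation rings are quasicompact in the Zariski topology. -/
theorem isCompact_zariskiTop_of_isClosed_patchTop {D : Subring F} {Z : Set (zarSet D)}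
    (hZ : @IsClosed _ (patchTop (zarSet D)) Z) : @IsCompact _ (zariskiTop (zarSet D)) Z := by
  have hpatch (f : Ultrafilter (zarSet D)) :
      (f : Filter _) ≤ @nhds _ (patchTop (zarSet D)) ⟨_, ultrafilterLimit_mem_zarSet f⟩ := by
    rw [patchTop, TopologicalSpace.nhds_generateFrom]
    refine le_iInf₂ fun W hW => Filter.le_principal_iff.2 ?_
    obtain ⟨hm, ⟨hU, -⟩ | ⟨U, hU, hc, rfl⟩⟩ := hW
    · exact mem_of_isOpen_zariskiTop hU hm
    · rw [Ultrafilter.mem_coe, Ultrafilter.compl_mem_iff_notMem]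
      exact fun hf => hm (ultrafilterLimit_mem_of_isCompact hU hc hf)
  let _ := zariskiTop (zarSet D)
  refine isCompact_iff_ultrafilter_le_nhds.2 fun f hf => ⟨⟨_, ultrafilterLimit_mem_zarSet f⟩,
    ?_, fun W hW => ?_⟩
  · by_contra hn
    have h := hpatch f (@IsOpen.mem_nhds _ (patchTop (zarSet D)) _ Zᶜ
      (@IsClosed.isOpen_compl _ (patchTop (zarSet D)) Z hZ) hn)
    exact (Ultrafilter.compl_mem_iff_notMem.1 h) (Filter.le_principal_iff.1 hf)
  · obtain ⟨U, hUW, hU, hm⟩ := mem_nhds_iff.1 hW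
    exact Filter.mem_of_superset (mem_of_isOpen_zariskiTop hU hm) hUW

/-- The domination map to a projective model is continuous. -/
theorem IsProjModel.isOpen_setOf_dominates {D : Subring F} {X : Set (Subring F)}
    (hX : IsProjModel D X) {u : Set X} (hu : @IsOpen _ (zariskiTop X) u) :
    @IsOpen _ (zariskiTop (zarSet D)) {V | ∃ α ∈ u, Dominates V.1 α.1} := by
  classical
  rw [isOpen_zariskiTop_iff] at hu ⊢
  rintro V ⟨α, hαu, hVα⟩
  obtain ⟨s, hs, hsu⟩ := hu α hαu
  obtain ⟨n, x, hx, hXeq⟩ := id hX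
  obtain ⟨α, hα⟩ := α
  obtain ⟨i, P, hP, rfl⟩ : ∃ (i : Fin (n + 1)) (P : Ideal (modelChart D x i)),
    P.IsPrime ∧ α = localizationSubring (modelChart D x i) P := by rwa [hXeq] at hα
  have hfrac : ∀ z : F, ∃ a b : modelChart D x i, z ∈ s → b ∉ P ∧ z = (a : F) * (b : F)⁻¹ := by
    intro z
    by_cases hz : z ∈ s
    · obtain ⟨a, b, h⟩ := (mem_localizationSubring_iff _ P z).1 (hs z hz)
      exact ⟨a, b, fun _ => h⟩
    · exact ⟨0, 0, fun h => absurd h hz⟩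
  choose a b hab using hfrac
  refine ⟨s.image (fun z => (b z : F)⁻¹) ∪ Finset.univ.image (fun j => x j * (x i)⁻¹),
    fun y hy => ?_, fun W hW => ?_⟩
  · simp only [Finset.mem_union, Finset.mem_image, Finset.mem_univ, true_and] at hy
    obtain ⟨z, hz, rfl⟩ | ⟨j, rfl⟩ := hy
    · exact hVα.1 (inv_mem_localizationSubring _ P (hab z hz).1)
    · exact hVα.1 (le_localizationSubring _ P (div_mem_modelChart D x i j))
  · have hchart : modelChart D x i ≤ W.1 := modelChart_le W.2.2 fun j =>
      hW _ (Finset.mem_union_right _ (Finset.mem_image_of_mem _ (Finset.mem_univ j)))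
    obtain ⟨Q, hQ, hd⟩ := W.2.1.exists_dominates_localizationSubring hchart
    have hmem : localizationSubring (modelChart D x i) Q ∈ X := by
      rw [hXeq]; exact ⟨i, Q, hQ, rfl⟩
    refine ⟨⟨_, hmem⟩, hsu _ fun z hz => ?_, hd⟩
    have hle := le_localizationSubring (modelChart D x i) Q
    change z ∈ localizationSubring (modelChart D x i) Q
    rw [(hab z hz).2]
    exact Subring.mul_mem _ (hle (a z).2) (hd.inv_mem (hle (b z).2)
      (hW _ (Finset.mem_union_left _ (Finset.mem_image_of_mem _ hz))))

/-- For each finite set `S` there is a projective model such that a member dominated by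
`V` contains the elements of `S` that lie in `V`. -/
theorem exists_isProjModel_forall_mem (D : Subring F) (S : Finset F) :
    ∃ X : Set (Subring F), IsProjModel D X ∧
      ∀ V α : Subring F, α ∈ X → Dominates V α → ∀ y ∈ S, y ∈ V → y ∈ α := by
  classical
  let T := S.filter (· ≠ 0)
  have hcard : T.powerset.card = (2 ^ T.card - 1) + 1 := by
    rw [Finset.card_powerset, Nat.sub_add_cancel Nat.one_le_two_pow]
  let e := (Finset.equivFinOfCardEq hcard).symm
  let x : Fin ((2 ^ T.card - 1) + 1) → F := fun i => ∏ y ∈ (e i).1, y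
  have hT (i) : (e i).1 ⊆ T := Finset.mem_powerset.1 (e i).2
  have hx (i) : x i ≠ 0 :=
    Finset.prod_ne_zero_iff.2 fun y hy => (Finset.mem_filter.1 (hT i hy)).2
  have hsurj (U : Finset F) (hU : U ⊆ T) : ∃ i, x i = ∏ y ∈ U, y :=
    ⟨e.symm ⟨U, Finset.mem_powerset.2 hU⟩, by simp [x]⟩
  refine ⟨_, ⟨_, x, hx, rfl⟩, ?_⟩
  rintro V _ ⟨i, P, hP, rfl⟩ hd y hyS hyV
  have hle := le_localizationSubring (modelChart D x i) P
  by_cases hy0 : y = 0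
  · exact hy0 ▸ Subring.zero_mem _
  have hyT : y ∈ T := Finset.mem_filter.2 ⟨hyS, hy0⟩
  by_cases hyi : y ∈ (e i).1
  · obtain ⟨j, hj⟩ := hsurj ((e i).1.erase y) ((Finset.erase_subset _ _).trans (hT i))
    have hxi : x i = y * x j := by rw [hj]; exact (Finset.mul_prod_erase _ _ hyi).symm
    have hmem := hle (div_mem_modelChart D x i j)
    have hinv : x j * (x i)⁻¹ = y⁻¹ := by
      rw [hxi, mul_inv, mul_comm, mul_assoc, inv_mul_cancel₀ (hx j), mul_one]
    rw [hinv] at hmem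
    have := hd.inv_mem hmem (by rwa [inv_inv])
    rwa [inv_inv] at this
  · obtain ⟨j, hj⟩ := hsurj (insert y (e i).1) (Finset.insert_subset hyT (hT i))
    have hxj : x j = y * x i := by rw [hj]; exact Finset.prod_insert hyi
    have hmem := hle (div_mem_modelChart D x i j)
    rwa [hxj, mul_assoc, mul_inv_cancel₀ (hx i), mul_one] at hmem

/-- A quasicompact set covered by two Zariski open sets is covered by basic open sets
subordinate to them and given by subsets of a single finite set. -/
theorem exists_finset_of_isCompact {X : Set (Subring F)} {Z u v : Set X}
    (hZ : @IsCompact _ (zariskiTop X) Z) (hu : @IsOpen _ (zariskiTop X) u)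
    (hv : @IsOpen _ (zariskiTop X) v) (hsub : Z ⊆ u ∪ v) :
    ∃ S : Finset F, ∀ V ∈ Z, ∃ s ⊆ S, (∀ x ∈ s, x ∈ V.1) ∧
      ({R : X | ∀ x ∈ s, x ∈ R.1} ⊆ u ∨ {R : X | ∀ x ∈ s, x ∈ R.1} ⊆ v) := by
  classical
  let _ := zariskiTop X
  refine hZ.induction_on
    (p := fun K => ∃ S : Finset F, ∀ V ∈ K, ∃ s ⊆ S, (∀ x ∈ s, x ∈ V.1) ∧
      ({R : X | ∀ x ∈ s, x ∈ R.1} ⊆ u ∨ {R : X | ∀ x ∈ s, x ∈ R.1} ⊆ v)) ?_ ?_ ?_ ?_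
  · exact ⟨∅, by simp⟩
  · rintro K L hKL ⟨S, hS⟩
    exact ⟨S, fun V hV => hS V (hKL hV)⟩
  · rintro K L ⟨S, hS⟩ ⟨T, hT⟩
    refine ⟨S ∪ T, ?_⟩
    rintro V (hV | hV)
    · obtain ⟨s, hs, h⟩ := hS V hV
      exact ⟨s, hs.trans Finset.subset_union_left, h⟩
    · obtain ⟨s, hs, h⟩ := hT V hV
      exact ⟨s, hs.trans Finset.subset_union_right, h⟩
  · intro V hV
    obtain ⟨s, hs, h⟩ : ∃ s : Finset F, (∀ x ∈ s, x ∈ V.1) ∧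
        ({R : X | ∀ x ∈ s, x ∈ R.1} ⊆ u ∨ {R : X | ∀ x ∈ s, x ∈ R.1} ⊆ v) := by
      rcases hsub hV with hVu | hVv
      · obtain ⟨s, hs, h⟩ := isOpen_zariskiTop_iff.1 hu V hVu
        exact ⟨s, hs, Or.inl h⟩
      · obtain ⟨s, hs, h⟩ := isOpen_zariskiTop_iff.1 hv V hVv
        exact ⟨s, hs, Or.inr h⟩
    refine ⟨{R : X | ∀ x ∈ s, x ∈ R.1}, mem_nhdsWithin_of_mem_nhds (IsOpen.mem_nhds ?_ hs),
      s, fun W hW => ⟨s, subset_rfl, hW, h⟩⟩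
    exact TopologicalSpace.isOpen_generateFrom_of_mem ⟨s, rfl⟩

/-- The image of a Zariski connected set in a projective model is connected. -/
theorem IsProjModel.isConnected_of_isConnected {D : Subring F} {X : Set (Subring F)}
    (hX : IsProjModel D X) {Z : Set (zarSet D)}
    (hZ : @IsConnected _ (zariskiTop (zarSet D)) Z) :
    @IsConnected _ (zariskiTop X) {α : X | ∃ V ∈ Z, Dominates V.1 α.1} := by
  obtain ⟨⟨V, hV⟩, hpre⟩ := hZ
  obtain ⟨α, hα, hd⟩ := hX.exists_dominates V.2
  refine ⟨⟨⟨α, hα⟩, V, hV, hd⟩, ?_⟩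
  rintro u v hu hv hsub ⟨β, ⟨V₁, hV₁, hd₁⟩, hβ⟩ ⟨γ, ⟨V₂, hV₂, hd₂⟩, hγ⟩
  obtain ⟨W, hW, ⟨δ, hδu, hδ⟩, ⟨ε, hεv, hε⟩⟩ := hpre _ _ (hX.isOpen_setOf_dominates hu)
    (hX.isOpen_setOf_dominates hv)
    (fun W hW => by
      obtain ⟨δ, hδ, hWδ⟩ := hX.exists_dominates W.2
      exact (hsub (a := ⟨δ, hδ⟩) ⟨W, hW, hWδ⟩).imp (fun h => ⟨_, h, hWδ⟩) fun h => ⟨_, h, hWδ⟩)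
    ⟨V₁, hV₁, β, hβ, hd₁⟩ ⟨V₂, hV₂, γ, hγ, hd₂⟩
  have heq : δ = ε := Subtype.ext (hX.eq_of_dominates δ.2 ε.2 hδ hε)
  exact ⟨δ, ⟨W, hW, hδ⟩, hδu, heq ▸ hεv⟩

/-- A quasicompact set of valuation rings is preconnected if its images in the projective
models are. -/
theorem isPreconnected_of_forall_isProjModel {D : Subring F} {Z : Set (zarSet D)}
    (hc : @IsCompact _ (zariskiTop (zarSet D)) Z)
    (h : ∀ X : Set (Subring F), IsProjModel D X →
      @IsPreconnected _ (zariskiTop X) {α : X | ∃ V ∈ Z, Dominates V.1 α.1}) :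
    @IsPreconnected _ (zariskiTop (zarSet D)) Z := by
  rintro u v hu hv hsub ⟨V₁, hV₁, hV₁u⟩ ⟨V₂, hV₂, hV₂v⟩
  obtain ⟨S, hS⟩ := exists_finset_of_isCompact hc hu hv hsub
  obtain ⟨X, hX, hXS⟩ := exists_isProjModel_forall_mem D S
  let t (w : Set (zarSet D)) : Set X := {α | ∃ s : Finset F, (∀ x ∈ s, x ∈ α.1) ∧
    {R : zarSet D | ∀ x ∈ s, x ∈ R.1} ⊆ w}
  have ht (w) : @IsOpen _ (zariskiTop X) (t w) :=
    isOpen_zariskiTop_iff.2 fun α ⟨s, hs, hsw⟩ => ⟨s, hs, fun β hβ => ⟨s, hβ, hsw⟩⟩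
  have hmem (w) {V : zarSet D} {α : X} (hd : Dominates V.1 α.1) (hα : α ∈ t w) : V ∈ w := by
    obtain ⟨s, hs, hsw⟩ := hα
    exact hsw fun x hx => hd.1 (hs x hx)
  have hcov {V : zarSet D} (hV : V ∈ Z) {α : X} (hd : Dominates V.1 α.1) :
      α ∈ t u ∪ t v := by
    obtain ⟨s, hsS, hsV, h⟩ := hS V hV
    have hsα : ∀ x ∈ s, x ∈ α.1 := fun x hx => hXS _ _ α.2 hd x (hsS hx) (hsV x hx)
    exact h.imp (fun h => ⟨s, hsα, h⟩) fun h => ⟨s, hsα, h⟩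
  obtain ⟨α₁, hα₁, hd₁⟩ := hX.exists_dominates V₁.2
  obtain ⟨α₂, hα₂, hd₂⟩ := hX.exists_dominates V₂.2
  by_contra hne
  have hne' {V : zarSet D} (hV : V ∈ Z) (hVu : V ∈ u) (hVv : V ∈ v) : False :=
    hne ⟨V, hV, hVu, hVv⟩
  obtain ⟨β, ⟨W, hW, hd⟩, hβu, hβv⟩ := h X hX (t u) (t v) (ht u) (ht v)
    (fun α ⟨V, hV, hd⟩ => hcov hV hd)
    ⟨⟨α₁, hα₁⟩, ⟨V₁, hV₁, hd₁⟩, (hcov hV₁ (α := ⟨α₁, hα₁⟩) hd₁).resolve_right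
      fun h => hne' hV₁ hV₁u (hmem v hd₁ h)⟩
    ⟨⟨α₂, hα₂⟩, ⟨V₂, hV₂, hd₂⟩, (hcov hV₂ (α := ⟨α₂, hα₂⟩) hd₂).resolve_left
      fun h => hne' hV₂ (hmem u hd₂ h) hV₂v⟩
  exact hne' hW (hmem u hd hβu) (hmem v hd hβv)

/-- A nonempty patch closed subset `Z` of `Zar_F(D)` is Zariski connected if and only
if `X(Z)` is Zariski connected for every projective model `X` of `F/D`. -/
theorem statement13 (D : Subring F) (Z : Set ↥(zarSet D))
    (hne : Z.Nonempty) (hpc : @IsClosed _ (patchTop (zarSet D)) Z) :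
    @IsConnected _ (zariskiTop (zarSet D)) Z ↔
      ∀ X : Set (Subring F), IsProjModel D X →
        @IsConnected _ (zariskiTop X) {α : ↥X | ∃ V ∈ Z, Dominates V.1 α.1} := by
  exact ⟨fun hZ X hX => hX.isConnected_of_isConnected hZ, fun h =>
    ⟨hne, isPreconnected_of_forall_isProjModel
      (isCompact_zariskiTop_of_isClosed_patchTop hpc) fun X hX => (h X hX).2⟩⟩
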